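/- Let p be a constant with 1 − 1/√2 < p < 1 (independent of n). Then asymptotically almost surely a random graph Γ ∈ G(n, p) is star 2-connected. -/

import Mathlib

open Finset Filter Topology

attribute [local instance] Classical.propDecidable

/-- The Erdős–Rényi weight of a graph `Γ` on `n` vertices with edge probability `p`:
`p^{E_Γ} (1-p)^{C(n,2) - E_Γ}`. -/
noncomputable def gnpWeight (n : ℕ) (p : ℝ) (Γ : SimpleGraph (Fin n)) : ℝ :=
  p ^ Γ.edgeSet.ncard * (1 - p) ^ (n.choose 2 - Γ.edgeSet.ncard)

/-- The probability of the event `A` under the Erdős–Rényi model `G(n,p)`. -/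
noncomputable def gnpProb (n : ℕ) (p : ℝ) (A : SimpleGraph (Fin n) → Prop) : ℝ :=
  ∑ Γ : SimpleGraph (Fin n), if A Γ then gnpWeight n p Γ else 0

/-- The expectation of a random variable `X` under the Erdős–Rényi model `G(n,p)`. -/
noncomputable def gnpExp (n : ℕ) (p : ℝ) (X : SimpleGraph (Fin n) → ℝ) : ℝ :=
  ∑ Γ : SimpleGraph (Fin n), gnpWeight n p Γ * X Γ

/-- A graph is star 2-connected if there is no vertex `v` and no partition of the
vertices outside `st(v)` into two nonempty sets `S`, `T` with no edge joining `S` to `T`. -/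
def StarTwoConnected {n : ℕ} (Γ : SimpleGraph (Fin n)) : Prop :=
  ¬ ∃ (v : Fin n) (S T : Finset (Fin n)),
      S.Nonempty ∧ T.Nonempty ∧ Disjoint S T ∧
      (∀ u : Fin n, u ∈ S ∪ T ↔ (u ≠ v ∧ ¬ Γ.Adj v u)) ∧
      (∀ s ∈ S, ∀ t ∈ T, ¬ Γ.Adj s t)

/-- The Erdős–Rényi sum over graphs, rewritten as a sum over sets of edges of the complete graph. -/
lemma sum_simpleGraph_eq_sum_powerset {n : ℕ} (F : Finset (Sym2 (Fin n)) → ℝ) :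
    ∑ Γ : SimpleGraph (Fin n), F Γ.edgeFinset =
      ∑ t ∈ (⊤ : SimpleGraph (Fin n)).edgeFinset.powerset, F t := by
  refine Finset.sum_bij (fun Γ _ => Γ.edgeFinset) ?_ ?_ ?_ ?_
  · intro Γ _
    rw [Finset.mem_powerset]
    exact SimpleGraph.edgeFinset_mono le_top
  · intro Γ _ Γ' _ h
    exact SimpleGraph.edgeFinset_inj.mp h
  · intro t ht
    obtain ⟨Γ, hΓ⟩ : ∃ Γ : SimpleGraph (Fin n), Γ.edgeSet = t := by
      refine ⟨SimpleGraph.fromEdgeSet t, ?_⟩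
      rw [SimpleGraph.edgeSet_fromEdgeSet]
      refine Set.Subset.antisymm Set.sdiff_subset fun e he => ⟨he, ?_⟩
      have hK := Finset.mem_powerset.mp ht he
      rwa [SimpleGraph.mem_edgeFinset, SimpleGraph.edgeSet_top] at hK
    refine ⟨Γ, Finset.mem_univ _, ?_⟩
    ext e
    rw [SimpleGraph.mem_edgeFinset, hΓ, Finset.mem_coe]
  · intro Γ _
    rfl

lemma gnpWeight_eq {n : ℕ} (p : ℝ) (Γ : SimpleGraph (Fin n)) :
    gnpWeight n p Γ = p ^ #Γ.edgeFinset *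
      (1 - p) ^ #((⊤ : SimpleGraph (Fin n)).edgeFinset \ Γ.edgeFinset) := by
  have hsub : Γ.edgeFinset ⊆ (⊤ : SimpleGraph (Fin n)).edgeFinset :=
    SimpleGraph.edgeFinset_mono le_top
  have hcard : Γ.edgeSet.ncard = #Γ.edgeFinset := by
    rw [← SimpleGraph.coe_edgeFinset, Set.ncard_coe_finset]
  have htop : #(⊤ : SimpleGraph (Fin n)).edgeFinset = n.choose 2 := by
    have := SimpleGraph.card_edgeFinset_top_eq_card_choose_two (V := Fin n)
    rw [Fintype.card_fin] at this
    convert this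
  rw [gnpWeight, hcard, Finset.card_sdiff_of_subset hsub, htop]

lemma gnpWeight_nonneg {n : ℕ} {p : ℝ} (hp : 0 ≤ p) (hp1 : p ≤ 1) (Γ : SimpleGraph (Fin n)) :
    0 ≤ gnpWeight n p Γ :=
  mul_nonneg (pow_nonneg hp _) (pow_nonneg (sub_nonneg.mpr hp1) _)

/-- The probability that all edges of `E₁` are present and all edges of `E₀` are absent. -/
lemma gnpProb_prescribed {n : ℕ} (p : ℝ) {E₁ E₀ : Finset (Sym2 (Fin n))}
    (h₁ : E₁ ⊆ (⊤ : SimpleGraph (Fin n)).edgeFinset)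
    (h₀ : E₀ ⊆ (⊤ : SimpleGraph (Fin n)).edgeFinset) (hd : Disjoint E₁ E₀) :
    gnpProb n p (fun Γ => E₁ ⊆ Γ.edgeFinset ∧ Disjoint E₀ Γ.edgeFinset) =
      p ^ #E₁ * (1 - p) ^ #E₀ := by
  set K := (⊤ : SimpleGraph (Fin n)).edgeFinset with hK
  let f : Sym2 (Fin n) → ℝ := fun e => if e ∈ E₀ then 0 else p
  let g : Sym2 (Fin n) → ℝ := fun e => if e ∈ E₁ then 0 else 1 - p
  have hprod : ∏ e ∈ K, (f e + g e) = p ^ #E₁ * (1 - p) ^ #E₀ := by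
    have hfg : ∀ e ∈ K, f e + g e =
        (if e ∈ E₁ then p else 1) * (if e ∈ E₀ then 1 - p else 1) := by
      intro e _
      by_cases ha : e ∈ E₁
      · have hb : e ∉ E₀ := Finset.disjoint_left.mp hd ha
        simp [f, g, ha, hb]
      · by_cases hb : e ∈ E₀ <;> simp [f, g, ha, hb]
    rw [Finset.prod_congr rfl hfg, Finset.prod_mul_distrib, Finset.prod_ite_mem,
      Finset.prod_ite_mem, Finset.inter_eq_right.mpr h₁, Finset.inter_eq_right.mpr h₀,
      Finset.prod_const, Finset.prod_const]
  rw [← hprod, Finset.prod_add, ← sum_simpleGraph_eq_sum_powerset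
    (fun t => (∏ i ∈ t, f i) * ∏ i ∈ K \ t, g i), gnpProb]
  refine Finset.sum_congr rfl fun Γ _ => ?_
  split_ifs with h
  · have hf : ∏ i ∈ Γ.edgeFinset, f i = p ^ #Γ.edgeFinset := by
      rw [← Finset.prod_const]
      exact Finset.prod_congr rfl fun e he => if_neg (Finset.disjoint_right.mp h.2 he)
    have hg : ∏ i ∈ K \ Γ.edgeFinset, g i = (1 - p) ^ #(K \ Γ.edgeFinset) := by
      rw [← Finset.prod_const]
      exact Finset.prod_congr rfl fun e he =>
        if_neg fun h' => (Finset.mem_sdiff.mp he).2 (h.1 h')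
    rw [hf, hg, gnpWeight_eq]
  · rw [not_and_or] at h
    rcases h with h | h
    · obtain ⟨e, he, he'⟩ := Finset.not_subset.mp h
      have : ∏ i ∈ K \ Γ.edgeFinset, g i = 0 :=
        Finset.prod_eq_zero (Finset.mem_sdiff.mpr ⟨h₁ he, he'⟩) (if_pos he)
      rw [this, mul_zero]
    · obtain ⟨e, he, he'⟩ := Finset.not_disjoint_iff.mp h
      have : ∏ i ∈ Γ.edgeFinset, f i = 0 := Finset.prod_eq_zero he' (if_pos he)
      rw [this, zero_mul]

lemma gnpProb_add_not {n : ℕ} (p : ℝ) (A : SimpleGraph (Fin n) → Prop) :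
    gnpProb n p A + gnpProb n p (fun Γ => ¬ A Γ) = 1 := by
  have h := gnpProb_prescribed (n := n) p (E₁ := ∅) (E₀ := ∅) (Finset.empty_subset _)
    (Finset.empty_subset _) (Finset.disjoint_empty_left _)
  simp only [Finset.card_empty, pow_zero, mul_one] at h
  rw [← h, gnpProb, gnpProb, gnpProb, ← Finset.sum_add_distrib]
  refine Finset.sum_congr rfl fun Γ _ => ?_
  by_cases hA : A Γ <;> simp [hA]

/-- Monotonicity of probability. -/
lemma gnpProb_mono {n : ℕ} {p : ℝ} (hp : 0 ≤ p) (hp1 : p ≤ 1) {A B : SimpleGraph (Fin n) → Prop}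
    (h : ∀ Γ, A Γ → B Γ) : gnpProb n p A ≤ gnpProb n p B := by
  refine Finset.sum_le_sum fun Γ _ => ?_
  have hw := gnpWeight_nonneg hp hp1 Γ
  by_cases hA : A Γ
  · simp [hA, h Γ hA]
  · rw [if_neg hA]
    split_ifs
    · exact hw
    · exact le_rfl

/-- The union bound. -/
lemma gnpProb_exists_le {n : ℕ} {p : ℝ} (hp : 0 ≤ p) (hp1 : p ≤ 1) {ι : Type*} (s : Finset ι)
    (A : ι → SimpleGraph (Fin n) → Prop) :
    gnpProb n p (fun Γ => ∃ i ∈ s, A i Γ) ≤ ∑ i ∈ s, gnpProb n p (A i) := by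
  simp only [gnpProb]
  rw [Finset.sum_comm]
  refine Finset.sum_le_sum fun Γ _ => ?_
  have hw := gnpWeight_nonneg hp hp1 Γ
  have hnn : ∀ i ∈ s, 0 ≤ if A i Γ then gnpWeight n p Γ else 0 := by
    intro i _
    split_ifs
    · exact hw
    · exact le_rfl
  split_ifs with h
  · obtain ⟨i, hi, hA⟩ := h
    calc gnpWeight n p Γ = if A i Γ then gnpWeight n p Γ else 0 := (if_pos hA).symm
      _ ≤ _ := Finset.single_le_sum hnn hi
  · exact Finset.sum_nonneg hnn

/-- `S` and `T` partition the complement of the star of `v`, with no edge joining them. -/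
def SeparatesStarComplement {n : ℕ} (v : Fin n) (S T : Finset (Fin n))
    (Γ : SimpleGraph (Fin n)) : Prop :=
  (∀ u : Fin n, u ∈ S ∪ T ↔ (u ≠ v ∧ ¬ Γ.Adj v u)) ∧ ∀ s ∈ S, ∀ t ∈ T, ¬ Γ.Adj s t

lemma gnpProb_separatesStarComplement_le {n : ℕ} {p : ℝ} (hp : 0 ≤ p) (hp1 : p ≤ 1) (v : Fin n)
    {S T : Finset (Fin n)} (hS : S ⊆ univ.erase v) (hT : T ⊆ univ.erase v \ S) :
    gnpProb n p (SeparatesStarComplement v S T) ≤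
      (1 - p) ^ (#S + #T + #S * #T) * p ^ (#(univ.erase v \ S) - #T) := by
  set R := (univ.erase v \ S) \ T with hR
  let c : Fin n → Sym2 (Fin n) := fun u => s(v, u)
  have hc : Function.Injective c := fun a b h => Sym2.congr_right.mp h
  have hvS : v ∉ S := fun h => (Finset.mem_erase.mp (hS h)).1 rfl
  have hvT : v ∉ T := fun h => (Finset.mem_erase.mp (Finset.mem_sdiff.mp (hT h)).1).1 rfl
  have hST : Disjoint S T :=
    Finset.disjoint_right.mpr fun x hx => (Finset.mem_sdiff.mp (hT hx)).2
  have hvR : v ∉ R := by simp [hR]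
  have hRS : ∀ u ∈ R, u ∉ S ∧ u ∉ T := by
    intro u hu
    simp only [hR, Finset.mem_sdiff] at hu
    exact ⟨hu.1.2, hu.2⟩
  let E₁ := R.image c
  let B := (S ×ˢ T).image fun x => s(x.1, x.2)
  let E₀ := (S ∪ T).image c ∪ B
  have hB : ∀ e ∈ B, v ∉ e := by
    intro e he hv
    obtain ⟨⟨a, b⟩, hab, rfl⟩ := Finset.mem_image.mp he
    rw [Finset.mem_product] at hab
    rcases Sym2.mem_iff.mp hv with rfl | rfl
    · exact hvS hab.1
    · exact hvT hab.2
  have hcB : ∀ X : Finset (Fin n), Disjoint (X.image c) B := by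
    intro X
    rw [Finset.disjoint_left]
    intro e he he'
    obtain ⟨u, _, rfl⟩ := Finset.mem_image.mp he
    exact hB _ he' (Sym2.mem_mk_left v u)
  have hcard₁ : #E₁ = #(univ.erase v \ S) - #T := by
    rw [Finset.card_image_of_injective _ hc, hR, Finset.card_sdiff_of_subset hT]
  have hcardB : #B = #S * #T := by
    rw [← Finset.card_product]
    refine Finset.card_image_of_injOn ?_
    rintro ⟨a, b⟩ hab ⟨x, y⟩ hxy h
    simp only [Finset.coe_product, Set.mem_prod, Finset.mem_coe] at hab hxy
    rcases Sym2.eq_iff.mp h with ⟨h₁, h₂⟩ | ⟨h₁, h₂⟩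
    · exact Prod.ext h₁ h₂
    · simp only at h₁
      exact absurd (h₁ ▸ hxy.2) (Finset.disjoint_left.mp hST hab.1)
  have hcard₀ : #E₀ = #S + #T + #S * #T := by
    rw [Finset.card_union_of_disjoint (hcB _), hcardB, Finset.card_image_of_injective _ hc,
      Finset.card_union_of_disjoint hST]
  have hctop : ∀ X : Finset (Fin n), v ∉ X →
      X.image c ⊆ (⊤ : SimpleGraph (Fin n)).edgeFinset := by
    intro X hX e he
    obtain ⟨u, hu, rfl⟩ := Finset.mem_image.mp he
    rw [SimpleGraph.mem_edgeFinset, SimpleGraph.mem_edgeSet, SimpleGraph.top_adj]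
    rintro rfl
    exact hX hu
  have h₁ : E₁ ⊆ (⊤ : SimpleGraph (Fin n)).edgeFinset := hctop R hvR
  have h₀ : E₀ ⊆ (⊤ : SimpleGraph (Fin n)).edgeFinset := by
    refine Finset.union_subset (hctop _ ?_) ?_
    · simp [hvS, hvT]
    · intro e he
      obtain ⟨⟨a, b⟩, hab, rfl⟩ := Finset.mem_image.mp he
      rw [Finset.mem_product] at hab
      rw [SimpleGraph.mem_edgeFinset, SimpleGraph.mem_edgeSet, SimpleGraph.top_adj]
      rintro h
      simp only at h hab
      exact Finset.disjoint_left.mp hST hab.1 (h ▸ hab.2)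
  have hd : Disjoint E₁ E₀ := by
    refine Finset.disjoint_union_right.mpr ⟨?_, hcB _⟩
    rw [Finset.disjoint_image hc, Finset.disjoint_left]
    intro u hu
    simp [hRS u hu]
  have key := gnpProb_prescribed p h₁ h₀ hd
  rw [hcard₁, hcard₀, mul_comm] at key
  rw [← key]
  refine gnpProb_mono hp hp1 ?_
  rintro Γ ⟨hstar, hsep⟩
  constructor
  · intro e he
    obtain ⟨u, hu, rfl⟩ := Finset.mem_image.mp he
    rw [SimpleGraph.mem_edgeFinset, SimpleGraph.mem_edgeSet]
    by_contra hadj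
    have huv : u ≠ v := by
      rintro rfl
      exact hvR hu
    have := (hstar u).mpr ⟨huv, hadj⟩
    simp [hRS u hu] at this
  · rw [Finset.disjoint_left]
    intro e he
    rw [SimpleGraph.mem_edgeFinset]
    rcases Finset.mem_union.mp he with he | he
    · obtain ⟨u, hu, rfl⟩ := Finset.mem_image.mp he
      exact ((hstar u).mp hu).2
    · obtain ⟨⟨a, b⟩, hab, rfl⟩ := Finset.mem_image.mp he
      rw [Finset.mem_product] at hab
      exact hsep a hab.1 b hab.2

/-- A trinomial theorem over ordered pairs of disjoint subsets. -/
lemma sum_pow_disjoint_subsets {α : Type*} [DecidableEq α] (a b c : ℝ) (U : Finset α) :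
    ∑ S ∈ U.powerset, ∑ T ∈ (U \ S).powerset, a ^ #S * b ^ #T * c ^ (#(U \ S) - #T) =
      (a + (b + c)) ^ #U := by
  rw [← Finset.sum_pow_mul_eq_add_pow]
  refine Finset.sum_congr rfl fun S hS => ?_
  rw [← Finset.card_sdiff_of_subset (Finset.mem_powerset.mp hS), ← Finset.sum_pow_mul_eq_add_pow,
    Finset.mul_sum]
  simp only [mul_assoc]

lemma pow_add_add_mul_le {q ε : ℝ} (hq : 0 < q) (hq1 : q ≤ 1) (hε : 0 < ε) {s t : ℕ}
    (hs : 1 ≤ s) (ht : 1 ≤ t) :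
    q ^ (s + t + s * t) ≤ ε⁻¹ * (ε ^ s * (q ^ 2) ^ t) + ε⁻¹ * ((q ^ 2) ^ s * ε ^ t) +
      (q ^ 4)⁻¹ * ((q ^ 3) ^ s * (q ^ 3) ^ t) := by
  have hA : 0 ≤ ε⁻¹ * (ε ^ s * (q ^ 2) ^ t) := by positivity
  have hB : 0 ≤ ε⁻¹ * ((q ^ 2) ^ s * ε ^ t) := by positivity
  have hC : 0 ≤ (q ^ 4)⁻¹ * ((q ^ 3) ^ s * (q ^ 3) ^ t) := by positivity
  rcases hs.eq_or_lt with rfl | hs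
  · have : q ^ (1 + t + 1 * t) ≤ ε⁻¹ * (ε ^ 1 * (q ^ 2) ^ t) := by
      rw [pow_one, inv_mul_cancel_left₀ hε.ne', ← pow_mul]
      exact pow_le_pow_of_le_one hq.le hq1 (by omega)
    linarith
  · rcases ht.eq_or_lt with rfl | ht
    · have : q ^ (s + 1 + s * 1) ≤ ε⁻¹ * ((q ^ 2) ^ s * ε ^ 1) := by
        rw [pow_one, mul_comm _ ε, inv_mul_cancel_left₀ hε.ne', ← pow_mul]
        exact pow_le_pow_of_le_one hq.le hq1 (by omega)
      linarith
    · have : q ^ (s + t + s * t) ≤ (q ^ 4)⁻¹ * ((q ^ 3) ^ s * (q ^ 3) ^ t) := by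
        rw [le_inv_mul_iff₀ (by positivity), ← pow_mul, ← pow_mul, ← pow_add, ← pow_add]
        exact pow_le_pow_of_le_one hq.le hq1 (by nlinarith)
      linarith

lemma gnpProb_not_starTwoConnected_le {n : ℕ} {p ε : ℝ} (hp : 0 ≤ p) (hp1 : p < 1) (hε : 0 < ε) :
    gnpProb n p (fun Γ => ¬ StarTwoConnected Γ) ≤
      n * (ε⁻¹ * (ε + ((1 - p) ^ 2 + p)) ^ (n - 1) + ε⁻¹ * ((1 - p) ^ 2 + (ε + p)) ^ (n - 1) +
        ((1 - p) ^ 4)⁻¹ * ((1 - p) ^ 3 + ((1 - p) ^ 3 + p)) ^ (n - 1)) := by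
  set q := 1 - p with hq
  have hq0 : 0 < q := by linarith
  have hq1 : q ≤ 1 := by linarith
  have hunion : gnpProb n p (fun Γ => ¬ StarTwoConnected Γ) ≤
      ∑ v : Fin n, ∑ S ∈ (univ.erase v).powerset, ∑ T ∈ (univ.erase v \ S).powerset,
        gnpProb n p (fun Γ => S.Nonempty ∧ T.Nonempty ∧ SeparatesStarComplement v S T Γ) := by
    refine le_trans (gnpProb_mono hp hp1.le ?_) ((gnpProb_exists_le hp hp1.le univ _).trans
      (Finset.sum_le_sum fun v _ => (gnpProb_exists_le hp hp1.le _ _).trans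
        (Finset.sum_le_sum fun S _ => gnpProb_exists_le hp hp1.le _ _)))
    intro Γ h
    obtain ⟨v, S, T, hS, hT, hST, hstar, hsep⟩ := not_not.mp h
    refine ⟨v, Finset.mem_univ v, S, ?_, T, ?_, hS, hT, hstar, hsep⟩
    · rw [Finset.mem_powerset]
      intro u hu
      simp [((hstar u).mp (Finset.mem_union_left T hu)).1]
    · rw [Finset.mem_powerset]
      intro u hu
      simp [((hstar u).mp (Finset.mem_union_right S hu)).1, Finset.disjoint_right.mp hST hu]
  refine hunion.trans ?_
  have hv : ∀ v : Fin n, ∑ S ∈ (univ.erase v).powerset, ∑ T ∈ (univ.erase v \ S).powerset,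
        gnpProb n p (fun Γ => S.Nonempty ∧ T.Nonempty ∧ SeparatesStarComplement v S T Γ) ≤
      ε⁻¹ * (ε + (q ^ 2 + p)) ^ (n - 1) + ε⁻¹ * (q ^ 2 + (ε + p)) ^ (n - 1) +
        (q ^ 4)⁻¹ * (q ^ 3 + (q ^ 3 + p)) ^ (n - 1) := by
    intro v
    have hcard : #(univ.erase v) = n - 1 := by
      rw [Finset.card_erase_of_mem (Finset.mem_univ v), Finset.card_univ, Fintype.card_fin]
    rw [← hcard, ← sum_pow_disjoint_subsets, ← sum_pow_disjoint_subsets,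
      ← sum_pow_disjoint_subsets]
    simp only [Finset.mul_sum, ← Finset.sum_add_distrib]
    refine Finset.sum_le_sum fun S hS => Finset.sum_le_sum fun T hT => ?_
    rw [Finset.mem_powerset] at hS hT
    by_cases hne : S.Nonempty ∧ T.Nonempty
    · calc gnpProb n p (fun Γ => S.Nonempty ∧ T.Nonempty ∧ SeparatesStarComplement v S T Γ)
          ≤ gnpProb n p (SeparatesStarComplement v S T) :=
            gnpProb_mono hp hp1.le fun Γ h => h.2.2
        _ ≤ q ^ (#S + #T + #S * #T) * p ^ (#(univ.erase v \ S) - #T) :=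
            gnpProb_separatesStarComplement_le hp hp1.le v hS hT
        _ ≤ _ := mul_le_mul_of_nonneg_right (pow_add_add_mul_le hq0 hq1 hε
            hne.1.card_pos hne.2.card_pos) (pow_nonneg hp _)
        _ = _ := by ring
    · have hzero : gnpProb n p (fun Γ => S.Nonempty ∧ T.Nonempty ∧
          SeparatesStarComplement v S T Γ) = 0 :=
        Finset.sum_eq_zero fun Γ _ => if_neg fun h => hne ⟨h.1, h.2.1⟩
      rw [hzero]
      positivity
  calc _ ≤ ∑ _v : Fin n, _ := Finset.sum_le_sum fun v _ => hv v
    _ = _ := by rw [Finset.sum_const, Finset.card_univ, Fintype.card_fin, nsmul_eq_mul]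

lemma tendsto_natCast_mul_pow_sub_one {r : ℝ} (hr : 0 ≤ r) (hr1 : r < 1) :
    Tendsto (fun n : ℕ => (n : ℝ) * r ^ (n - 1)) atTop (𝓝 0) := by
  rw [← tendsto_add_atTop_iff_nat 1]
  have h := (tendsto_self_mul_const_pow_of_lt_one hr hr1).add
    (tendsto_pow_atTop_nhds_zero_of_lt_one hr hr1)
  rw [add_zero] at h
  refine h.congr fun n => ?_
  rw [Nat.add_sub_cancel]
  push_cast
  ring

/-- For constant `p` with `1 - 1/√2 < p < 1`, a.a.s. `Γ ∈ G(n,p)` is star 2-connected. -/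
theorem gnp_aas_star_two_connected (p : ℝ) (h1 : 1 - 1 / Real.sqrt 2 < p) (h2 : p < 1) :
    Tendsto (fun n : ℕ => gnpProb n p (fun Γ => StarTwoConnected Γ)) atTop (nhds 1) := by
  have hq0 : 0 < 1 - p := by linarith
  have hq : (1 - p) ^ 2 < 1 / 2 := by
    have h := pow_lt_pow_left₀ (show 1 - p < 1 / Real.sqrt 2 by linarith) hq0.le two_ne_zero
    rwa [div_pow, one_pow, Real.sq_sqrt (by norm_num)] at h
  have hp0 : 0 < p := by nlinarith
  set ε := p * (1 - p) / 2 with hε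
  have hε0 : 0 < ε := by positivity
  have ha := tendsto_natCast_mul_pow_sub_one (r := ε + ((1 - p) ^ 2 + p)) (by positivity)
    (by rw [hε]; nlinarith [mul_pos hp0 hq0])
  have hb := tendsto_natCast_mul_pow_sub_one (r := (1 - p) ^ 2 + (ε + p)) (by positivity)
    (by rw [hε]; nlinarith [mul_pos hp0 hq0])
  have hc := tendsto_natCast_mul_pow_sub_one (r := (1 - p) ^ 3 + ((1 - p) ^ 3 + p))
    (by positivity) (by nlinarith)
  have hlim := ((ha.const_mul ε⁻¹).add (hb.const_mul ε⁻¹)).add (hc.const_mul ((1 - p) ^ 4)⁻¹)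
  simp only [mul_zero, add_zero] at hlim
  have hnot : Tendsto (fun n : ℕ => gnpProb n p (fun Γ => ¬ StarTwoConnected Γ)) atTop (𝓝 0) := by
    refine squeeze_zero (fun n => ?_) (fun n => ?_) hlim
    · refine Finset.sum_nonneg fun Γ _ => ?_
      split_ifs
      · exact gnpWeight_nonneg hp0.le h2.le Γ
      · exact le_rfl
    · exact (gnpProb_not_starTwoConnected_le hp0.le h2 hε0).trans_eq (by ring)
  have hone := hnot.const_sub 1
  rw [sub_zero] at hone
  exact hone.congr fun n => by rw [← gnpProb_add_not p fun Γ => StarTwoConnected Γ]; ring
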